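/- Every minimally unsatisfiable 2-clause-set F with deficiency δ(F) ≥ 2 is 2-uniform: F does not contain the empty clause and does not contain any unit-clause, so every clause of F has exactly two literals. -/

import Mathlib

/-- A literal: a variable (a natural number) together with a polarity. -/
abbrev Lit : Type := ℕ × Bool

/-- Complementation of literals: a fixed-point-free involution. -/
def Lit.compl (x : Lit) : Lit := (x.1, !x.2)

/-- The set of variables occurring in a clause-set. -/
def varsOf (F : Finset (Finset Lit)) : Finset ℕ := F.biUnion (fun C => C.image Prod.fst)

/-- The literals over the variables of `F` (both polarities). -/
def litsOf (F : Finset (Finset Lit)) : Finset Lit := varsOf F ×ˢ (Finset.univ : Finset Bool)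

/-- A clause is clash-free. -/
def IsClause (C : Finset Lit) : Prop := ∀ x ∈ C, Lit.compl x ∉ C

/-- A clause-set consists of clauses. -/
def IsClauseSet (F : Finset (Finset Lit)) : Prop := ∀ C ∈ F, IsClause C

/-- The truth value of a literal under a total assignment. -/
def LitVal (φ : ℕ → Bool) (x : Lit) : Bool := if x.2 then φ x.1 else !(φ x.1)

/-- Satisfiability of a clause-set. -/
def Sat (F : Finset (Finset Lit)) : Prop := ∃ φ : ℕ → Bool, ∀ C ∈ F, ∃ x ∈ C, LitVal φ x = true

/-- Minimal unsatisfiability. -/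
def MU (F : Finset (Finset Lit)) : Prop := IsClauseSet F ∧ ¬ Sat F ∧ ∀ G ⊂ F, Sat G

/-- Minimally unsatisfiable 2-clause-set. -/
def MU2 (F : Finset (Finset Lit)) : Prop := MU F ∧ ∀ C ∈ F, C.card ≤ 2

/-- The deficiency δ(F) = c(F) - n(F). -/
def deficiency (F : Finset (Finset Lit)) : ℤ := (F.card : ℤ) - ((varsOf F).card : ℤ)

/-- Literal-degree: number of clauses containing the literal. -/
def ldeg (F : Finset (Finset Lit)) (x : Lit) : ℕ := (F.filter (fun C => x ∈ C)).card

/-- Variable-degree. -/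
def vdeg (F : Finset (Finset Lit)) (v : ℕ) : ℕ := ldeg F (v, true) + ldeg F (v, false)

/-- Isomorphism of clause-sets: a bijection between the literals over the variables,
commuting with complementation, mapping one clause-set onto the other. -/
def CNFIso (F F' : Finset (Finset Lit)) (f : Lit → Lit) : Prop :=
  Set.BijOn f ↑(litsOf F) ↑(litsOf F') ∧
  (∀ x ∈ litsOf F, f (Lit.compl x) = Lit.compl (f x)) ∧
  F.image (fun C => C.image f) = F'

/-- A digraph: a finite vertex set and a finite set of arcs. -/
structure FinDigraph (α : Type) where
  V : Finset α
  E : Finset (α × α)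

/-- Well-formedness of a digraph: arcs join distinct vertices. -/
def FinDigraph.WellFormed {α : Type} (G : FinDigraph α) : Prop :=
  ∀ p ∈ G.E, p.1 ∈ G.V ∧ p.2 ∈ G.V ∧ p.1 ≠ p.2

/-- `f` is an isomorphism of digraphs from `G` to `G'`. -/
def DigraphIso {α β : Type} [DecidableEq β] (G : FinDigraph α) (G' : FinDigraph β) (f : α → β) : Prop :=
  Set.BijOn f ↑G.V ↑G'.V ∧ G.E.image (fun p => (f p.1, f p.2)) = G'.E

/-- The implication digraph of a 2-clause-set (without the empty clause):
vertices are the literals over the variables of `F`, and there is an arc `(a,b)` iff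
`{compl a} ∪ {b}` is a clause of `F` (this yields `(x̄,y),(ȳ,x)` for a clause `{x,y}`
and `(x̄,x)` for a unit-clause `{x}`). -/
def idg (F : Finset (Finset Lit)) : FinDigraph Lit :=
  ⟨litsOf F, (litsOf F ×ˢ litsOf F).filter (fun p => insert (Lit.compl p.1) {p.2} ∈ F)⟩

def FinDigraph.inDeg {α : Type} [DecidableEq α] (G : FinDigraph α) (v : α) : ℕ :=
  (G.E.filter (fun p => p.2 = v)).card

def FinDigraph.outDeg {α : Type} [DecidableEq α] (G : FinDigraph α) (v : α) : ℕ :=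
  (G.E.filter (fun p => p.1 = v)).card

/-- The standard double `m`-cycle. -/
def stdDoubleCycle (m : ℕ) : FinDigraph ℕ :=
  ⟨Finset.range m, (Finset.range m).biUnion (fun i => {(i, (i+1) % m), ((i+1) % m, i)})⟩

/-- A double `m`-cycle (`m ≥ 3`). -/
def IsDoubleCycle {α : Type} [DecidableEq α] (m : ℕ) (G : FinDigraph α) : Prop :=
  3 ≤ m ∧ ∃ f : ℕ → α, DigraphIso (stdDoubleCycle m) G f

/-- Splitting a vertex `x` into `u`, `v` with a new arc `(u,v)`:
arcs into `x` now go into `u`, arcs out of `x` now leave `v`. -/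
def SplitVertex {α : Type} [DecidableEq α] (G G' : FinDigraph α) : Prop :=
  ∃ x u v, x ∈ G.V ∧ u ∉ G.V ∧ v ∉ G.V ∧ u ≠ v ∧
    G'.V = insert u (insert v (G.V.erase x)) ∧
    G'.E = insert (u, v)
      ((G.E.filter (fun p => p.1 ≠ x ∧ p.2 ≠ x)) ∪
       ((G.E.filter (fun p => p.2 = x)).image (fun p => (p.1, u))) ∪
       ((G.E.filter (fun p => p.1 = x)).image (fun p => (v, p.2))))

/-- Splitting an arc `(x,y)` by a new (linear) vertex `v`. -/
def SplitArc {α : Type} [DecidableEq α] (G G' : FinDigraph α) : Prop :=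
  ∃ x y v, (x, y) ∈ G.E ∧ v ∉ G.V ∧
    G'.V = insert v G.V ∧
    G'.E = insert (x, v) (insert (v, y) (G.E.erase (x, y)))

/-- An `m`-weak-double-cycle: obtained from a double `m`-cycle by a finite sequence
of vertex splittings and arc splittings. -/
def IsWDC {α : Type} [DecidableEq α] (m : ℕ) (G : FinDigraph α) : Prop :=
  ∃ G₀ : FinDigraph α, IsDoubleCycle m G₀ ∧
    Relation.ReflTransGen (fun A B => SplitVertex A B ∨ SplitArc A B) G₀ G

/-- A digraph is nonlinear if no vertex has in-degree 1 and out-degree 1. -/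
def FinDigraph.Nonlinear {α : Type} [DecidableEq α] (G : FinDigraph α) : Prop :=
  ∀ v ∈ G.V, ¬ (G.inDeg v = 1 ∧ G.outDeg v = 1)

/-- Strong connectivity. -/
def StronglyConnected {α : Type} (G : FinDigraph α) : Prop :=
  ∀ a ∈ G.V, ∀ b ∈ G.V, Relation.ReflTransGen (fun x y => (x, y) ∈ G.E) a b

/-- A cycle digraph: strongly connected, at least 2 vertices, all vertices linear. -/
def IsCycleDigraph {α : Type} [DecidableEq α] (G : FinDigraph α) : Prop :=
  G.WellFormed ∧ 2 ≤ G.V.card ∧ StronglyConnected G ∧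
    ∀ v ∈ G.V, G.inDeg v = 1 ∧ G.outDeg v = 1

/-- A skew-symmetry of a digraph, as a permutation of its vertex set:
a fixed-point-free involution reversing arcs. -/
def IsSkewSym {α : Type} (G : FinDigraph α) (σ : Equiv.Perm {x // x ∈ G.V}) : Prop :=
  (∀ v, σ (σ v) = v) ∧ (∀ v, σ v ≠ v) ∧
  ∀ a b : {x // x ∈ G.V}, ((a : α), (b : α)) ∈ G.E → (((σ b : α)), ((σ a : α))) ∈ G.E

/-- A skew-symmetry has a unit if some vertex is joined by an arc to its image. -/
def HasUnit {α : Type} (G : FinDigraph α) (σ : Equiv.Perm {x // x ∈ G.V}) : Prop :=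
  ∃ v : {x // x ∈ G.V}, ((v : α), ((σ v : α))) ∈ G.E

/-- The literals over the variables of `F` are closed under complementation. -/
lemma compl_mem {F : Finset (Finset Lit)} {x : Lit} (h : x ∈ litsOf F) :
    Lit.compl x ∈ litsOf F := by
  simp only [litsOf, Lit.compl, Finset.mem_product] at h ⊢
  exact ⟨h.1, Finset.mem_univ _⟩

/-- Clause-set isomorphism, as an equivalence between the literals over the variables. -/
def CNFIsoE (F F' : Finset (Finset Lit))
    (e : {x // x ∈ litsOf F} ≃ {x // x ∈ litsOf F'}) : Prop :=
  (∀ x : {x // x ∈ litsOf F}, (e ⟨Lit.compl x.1, compl_mem x.2⟩ : Lit) = Lit.compl (e x : Lit)) ∧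
  F.image (fun C => C.image (fun y =>
      if h : y ∈ litsOf F then ((e ⟨y, h⟩ : {x // x ∈ litsOf F'}) : Lit) else y)) = F'

/-- An automorphism of a digraph, as a permutation of its vertex set preserving arcs. -/
def FinDigraphAut {α : Type} (G : FinDigraph α) (π : Equiv.Perm {x // x ∈ G.V}) : Prop :=
  ∀ a b : {x // x ∈ G.V}, ((a : α), (b : α)) ∈ G.E ↔ ((π a : α), (π b : α)) ∈ G.E

/-- Multiplicity of the edge between `u` and `v` in the underlying multigraph of a digraph. -/
def mult {α : Type} [DecidableEq α] (G : FinDigraph α) (u v : α) : ℕ :=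
  (if (u, v) ∈ G.E then 1 else 0) + (if (v, u) ∈ G.E then 1 else 0)

/-- `f` is an isomorphism between the underlying multigraphs of two digraphs. -/
def MultigraphIso {α β : Type} [DecidableEq α] [DecidableEq β]
    (G : FinDigraph α) (G' : FinDigraph β) (f : α → β) : Prop :=
  Set.BijOn f ↑G.V ↑G'.V ∧ ∀ u ∈ G.V, ∀ v ∈ G.V, mult G u v = mult G' (f u) (f v)

/-- `f` is an isomorphism between the underlying graphs of two digraphs. -/
def GraphIso {α β : Type} (G : FinDigraph α) (G' : FinDigraph β) (f : α → β) : Prop :=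
  Set.BijOn f ↑G.V ↑G'.V ∧ ∀ u ∈ G.V, ∀ v ∈ G.V,
    (((u, v) ∈ G.E ∨ (v, u) ∈ G.E) ↔ ((f u, f v) ∈ G'.E ∨ (f v, f u) ∈ G'.E))

/-- The transpose of a digraph: all arcs reversed. -/
def FinDigraph.transpose {α : Type} [DecidableEq α] (G : FinDigraph α) : FinDigraph α :=
  ⟨G.V, G.E.image (fun p => (p.2, p.1))⟩

/-- DP-reduction on variable `v`: replace all clauses containing `v` or `v̄` by all
their non-tautological resolvents on `v`. -/
def DP (v : ℕ) (F : Finset (Finset Lit)) : Finset (Finset Lit) :=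
  (F.filter (fun C => (v, true) ∉ C ∧ (v, false) ∉ C)) ∪
  ((((F.filter (fun C => (v, true) ∈ C)) ×ˢ (F.filter (fun C => (v, false) ∈ C))).image
      (fun p => (p.1.erase (v, true)) ∪ (p.2.erase (v, false)))).filter
    (fun C => ∀ x ∈ C, Lit.compl x ∉ C))

/-- A variable is singular if one of its literals has literal-degree 1. -/
def Singular (F : Finset (Finset Lit)) (v : ℕ) : Prop :=
  ldeg F (v, true) = 1 ∨ ldeg F (v, false) = 1

/-- The "middle part" `M_n = {{v̄_1,v_2},…,{v̄_{n−1},v_n}}`, with variables `1,…,n`. -/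
def Mn (n : ℕ) : Finset (Finset Lit) :=
  (Finset.Icc 1 (n - 1)).image (fun i => ({(i, false), (i + 1, true)} : Finset Lit))

def famU2 (n : ℕ) : Finset (Finset Lit) :=
  Mn n ∪ {({((1 : ℕ), true)} : Finset Lit), ({((n : ℕ), false)} : Finset Lit)}

def famU1 (n i : ℕ) : Finset (Finset Lit) :=
  Mn n ∪ {({((1 : ℕ), true)} : Finset Lit), ({((n : ℕ), false), ((i : ℕ), false)} : Finset Lit)}

def famU0s (n i : ℕ) : Finset (Finset Lit) :=
  Mn n ∪ {({((1 : ℕ), true), ((i : ℕ), true)} : Finset Lit),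
          ({((n : ℕ), false), ((i : ℕ), false)} : Finset Lit)}

def famU0 (n x y : ℕ) : Finset (Finset Lit) :=
  Mn n ∪ {({((1 : ℕ), true), ((x : ℕ), true)} : Finset Lit),
          ({((n : ℕ), false), ((y : ℕ), false)} : Finset Lit)}

/-- Membership in one of the four families (with the stated parameter ranges). -/
def InFam (G : Finset (Finset Lit)) : Prop :=
  (∃ n, 1 ≤ n ∧ G = famU2 n) ∨
  (∃ n i, 2 ≤ n ∧ 1 ≤ i ∧ i ≤ n - 1 ∧ G = famU1 n i) ∨
  (∃ n i, 3 ≤ n ∧ 2 ≤ i ∧ 2 * i ≤ n + 1 ∧ G = famU0s n i) ∨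
  (∃ n x y, 4 ≤ n ∧ 2 ≤ x ∧ x < y ∧ y ≤ n - 1 ∧ x + y ≤ n + 1 ∧ G = famU0 n x y)

/-- The number of unit-clauses of `F`. -/
def unitCount (F : Finset (Finset Lit)) : ℕ := (F.filter (fun C => C.card = 1)).card

/-- MU 2-clause-sets of deficiency `k` with exactly `n` variables. -/
def MU2dn (k : ℤ) (n : ℕ) : Type :=
  {F : Finset (Finset Lit) // MU2 F ∧ deficiency F = k ∧ (varsOf F).card = n}

/-- Isomorphism relation on `MU2dn k n`. -/
def isoRel {k : ℤ} {n : ℕ} (F F' : MU2dn k n) : Prop := ∃ f, CNFIso F.1 F'.1 f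

/-- The number of isomorphism classes of MU 2-clause-sets of deficiency `k`
with exactly `n` variables. -/
noncomputable def numClasses (k : ℤ) (n : ℕ) : ℕ := Nat.card (Quot (@isoRel k n))

/-- Equivalence of binary bracelets of length `m`: rotations and reflections of the
cyclic index set. -/
def BraceletRel (m : ℕ) (b b' : ZMod m → Bool) : Prop :=
  ∃ (r : ZMod m) (s : Bool), ∀ i, b' i = b (if s then r - i else i + r)

/-- Digraph-isomorphism relation on nonlinear `m`-WDCs. -/
def NonlinWDCRel (m : ℕ) (G G' : {G : FinDigraph ℕ // IsWDC m G ∧ G.Nonlinear}) : Prop :=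
  ∃ f : ℕ → ℕ, DigraphIso G.1 G'.1 f

/-- `H` is a subdigraph of `G`. -/
def Subdigraph {α : Type} (H G : FinDigraph α) : Prop := H.V ⊆ G.V ∧ H.E ⊆ G.E

/-- The assignment `φ` satisfies every clause of `F`. -/
def Satisfies (φ : ℕ → Bool) (F : Finset (Finset Lit)) : Prop :=
  ∀ C ∈ F, ∃ x ∈ C, LitVal φ x = true

/-- All satisfying assignments of `G` agree on the variables in `V`. -/
def Determines (G : Finset (Finset Lit)) (V : Finset ℕ) : Prop :=
  ∀ φ ψ, Satisfies φ G → Satisfies ψ G → ∀ v ∈ V, φ v = ψ v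

lemma LitVal_congr {φ ψ : ℕ → Bool} {x : Lit} (h : φ x.1 = ψ x.1) : LitVal φ x = LitVal ψ x := by
  simp [LitVal, h]

lemma eq_of_LitVal_eq {φ ψ : ℕ → Bool} {x : Lit} (h : LitVal φ x = LitVal ψ x) :
    φ x.1 = ψ x.1 := by
  unfold LitVal at h
  split at h <;> simpa using h

lemma fst_mem_varsOf {F : Finset (Finset Lit)} {C : Finset Lit} {x : Lit} (hC : C ∈ F)
    (hx : x ∈ C) : x.1 ∈ varsOf F :=
  Finset.mem_biUnion.2 ⟨C, hC, Finset.mem_image_of_mem _ hx⟩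

lemma Satisfies.mono {φ : ℕ → Bool} {F G : Finset (Finset Lit)} (h : Satisfies φ F)
    (hG : G ⊆ F) : Satisfies φ G :=
  fun C hC => h C (hG hC)

lemma MU.eq_of_subset {F G : Finset (Finset Lit)} (hF : MU F) (hG : G ⊆ F) (hs : ¬ Sat G) :
    G = F := by
  by_contra hne
  exact hs (hF.2.2 G (hG.ssubset_of_ne hne))

lemma MU.eq_singleton_empty {F : Finset (Finset Lit)} (hF : MU F) (h : ∅ ∈ F) : F = {∅} := by
  refine (hF.eq_of_subset (Finset.singleton_subset_iff.2 h) ?_).symm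
  rintro ⟨φ, hφ⟩
  simpa using hφ ∅ (by simp)

/-- A unit-propagation step: in an MU 2-clause-set of deficiency at least two, a set of variables
determined by few clauses, one of them a unit-clause, can be enlarged. -/
lemma MU2.exists_determines_insert {F G : Finset (Finset Lit)} {V : Finset ℕ} {x : Lit}
    (hF : MU2 F) (hd : (varsOf F).card + 1 < F.card) (hGF : G ⊆ F) (hx : {x} ∈ G)
    (hxV : x.1 ∈ V) (hVF : V ⊆ varsOf F) (hc : G.card ≤ V.card) (hD : Determines G V) :
    ∃ C ∈ F, ∃ d ∈ C, d.1 ∉ V ∧ Determines (insert C G) (insert d.1 V) := by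
  have hVc := Finset.card_le_card hVF
  obtain ⟨φ, hφ⟩ : Sat G := by
    by_contra hs
    have := hF.1.eq_of_subset hGF hs
    subst this
    omega
  obtain ⟨ψ, hψ⟩ : Sat (F.erase {x}) := hF.1.2.2 _ (Finset.erase_ssubset (hGF hx))
  let χ : ℕ → Bool := fun v => if v ∈ V then φ v else ψ v
  have hχV : ∀ v ∈ V, χ v = φ v := fun v hv => by simp [χ, hv]
  obtain ⟨C, hCF, hC⟩ : ∃ C ∈ F, ∀ y ∈ C, LitVal χ y ≠ true := by
    by_contra! h
    exact hF.1.2.1 ⟨χ, h⟩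
  have hCx : C ≠ {x} := by
    rintro rfl
    obtain ⟨y, hy, hyt⟩ := hφ _ hx
    obtain rfl := Finset.mem_singleton.1 hy
    exact hC y hy ((LitVal_congr (hχV _ hxV)).trans hyt)
  obtain ⟨b, hbC, hbt⟩ := hψ C (Finset.mem_erase.2 ⟨hCx, hCF⟩)
  have hbV : b.1 ∈ V := by
    by_contra hb
    exact hC b hbC ((LitVal_congr (by simp [χ, hb])).trans hbt)
  have hfalse : ∀ θ, Satisfies θ G → ∀ y ∈ C, y.1 ∈ V → LitVal θ y ≠ true := by
    intro θ hθ y hy hyV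
    rw [LitVal_congr ((hD θ φ hθ hφ _ hyV).trans (hχV _ hyV).symm)]
    exact hC y hy
  obtain ⟨d, hdC, hdV⟩ : ∃ d ∈ C, d.1 ∉ V := by
    by_contra! h
    have hs : ¬ Sat (insert C G) := by
      rintro ⟨θ, hθ⟩
      obtain ⟨y, hy, hyt⟩ := hθ C (Finset.mem_insert_self _ _)
      exact hfalse θ (Satisfies.mono hθ (Finset.subset_insert _ _)) y hy (h y hy) hyt
    have := hF.1.eq_of_subset (Finset.insert_subset hCF hGF) hs
    have := Finset.card_insert_le C G
    simp_all
    omega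
  have hCbd : C = {b, d} := by
    have hbd : b ≠ d := fun h => hdV (h ▸ hbV)
    refine (Finset.eq_of_subset_of_card_le ?_ ?_).symm
    · simp [Finset.insert_subset_iff, hbC, hdC]
    · rw [Finset.card_pair hbd]
      exact hF.2 C hCF
  have hdt : ∀ θ, Satisfies θ (insert C G) → LitVal θ d = true := by
    intro θ hθ
    obtain ⟨y, hy, hyt⟩ := hθ C (Finset.mem_insert_self _ _)
    have hyb : y ≠ b := by
      rintro rfl
      exact hfalse θ (hθ.mono (Finset.subset_insert _ _)) y hbC hbV hyt
    have : y = d := by simpa [hCbd, hyb] using hy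
    exact this ▸ hyt
  refine ⟨C, hCF, d, hdC, hdV, fun θ η hθ hη v hv => ?_⟩
  rcases Finset.mem_insert.1 hv with rfl | hv
  · exact eq_of_LitVal_eq ((hdt θ hθ).trans (hdt η hη).symm)
  · exact hD θ η (hθ.mono (Finset.subset_insert _ _)) (hη.mono (Finset.subset_insert _ _)) v hv

/-- An MU 2-clause-set with a unit-clause has deficiency at most one. -/
lemma MU2.card_le_of_unit {F : Finset (Finset Lit)} {x : Lit} (hF : MU2 F) (hx : {x} ∈ F) :
    F.card ≤ (varsOf F).card + 1 := by
  by_contra! hd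
  have key : ∀ k : ℕ, ∃ G V, G ⊆ F ∧ {x} ∈ G ∧ x.1 ∈ V ∧ V ⊆ varsOf F ∧ G.card ≤ V.card ∧
      Determines G V ∧ V.card = k + 1 := by
    intro k
    induction k with
    | zero =>
      refine ⟨{{x}}, {x.1}, by simpa using hx, by simp, by simp, ?_, by simp, ?_, by simp⟩
      · simpa using fst_mem_varsOf hx (Finset.mem_singleton_self x)
      · intro φ ψ hφ hψ v hv
        obtain rfl := Finset.mem_singleton.1 hv
        have h₁ : LitVal φ x = true := by simpa using hφ {x} (by simp)
        have h₂ : LitVal ψ x = true := by simpa using hψ {x} (by simp)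
        exact eq_of_LitVal_eq (h₁.trans h₂.symm)
    | succ k ih =>
      obtain ⟨G, V, hGF, hxG, hxV, hVF, hc, hD, hk⟩ := ih
      obtain ⟨C, hCF, d, hdC, hdV, hD'⟩ :=
        hF.exists_determines_insert hd hGF hxG hxV hVF hc hD
      have hcard := Finset.card_insert_of_notMem hdV
      have := Finset.card_insert_le C G
      exact ⟨insert C G, insert d.1 V, Finset.insert_subset hCF hGF, by simp [hxG], by simp [hxV],
        Finset.insert_subset (fst_mem_varsOf hCF hdC) hVF, by omega, hD', by omega⟩
  obtain ⟨G, V, -, -, -, hVF, -, -, hV⟩ := key (varsOf F).card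
  have := Finset.card_le_card hVF
  omega

theorem stmt16 (F : Finset (Finset Lit)) (hF : MU2 F) (hd : (2 : ℤ) ≤ deficiency F) :
    (∅ : Finset Lit) ∉ F ∧ (∀ C ∈ F, C.card ≠ 1) ∧ (∀ C ∈ F, C.card = 2) := by
  unfold deficiency at hd
  have h₀ : (∅ : Finset Lit) ∉ F := by
    intro h
    have := congrArg Finset.card (hF.1.eq_singleton_empty h)
    rw [Finset.card_singleton] at this
    omega
  have h₁ : ∀ C ∈ F, C.card ≠ 1 := by
    intro C hC h
    obtain ⟨x, rfl⟩ := Finset.card_eq_one.1 h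
    have := hF.card_le_of_unit hC
    omega
  refine ⟨h₀, h₁, fun C hC => ?_⟩
  have hne : C.card ≠ 0 := fun h => h₀ (Finset.card_eq_zero.1 h ▸ hC)
  have := h₁ C hC
  have := hF.2 C hC
  omega
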